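/- arXiv:2106.01606 — 2 statements merged into one kernel-verified Lean document; each statement's English description precedes it below -/
import Mathlib

section
/- For every pair of real constants ε ≥ 0 and K ≥ 0, the bound of Theorem 1 is tight: there exist real normed vector spaces E, Θ, F, a point x ∈ E, a map G : E → Θ → F satisfying ‖G(x', θ) − G(x, θ)‖ ≤ K·‖x' − x‖ for every x' in the closed ball of radius ε around x and every θ ∈ Θ, a map H : Θ → F such that for every θ ∈ Θ there is a point x*(θ) in the closed ball of radius ε around x with H(θ) = G(x*(θ), θ), and parameters θ₁, θ₂ ∈ Θ for which ‖H(θ₁) − H(θ₂)‖ = ‖G(x, θ₁) − G(x, θ₂)‖ + 2·ε·K. -/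
theorem adv_grad_stability_tight (ε K : ℝ) (hε : 0 ≤ ε) (hK : 0 ≤ K) :
    ∃ (E Θ F : Type) (_ : NormedAddCommGroup E) (_ : NormedSpace ℝ E)
      (_ : NormedAddCommGroup Θ) (_ : NormedSpace ℝ Θ)
      (_ : NormedAddCommGroup F) (_ : NormedSpace ℝ F)
      (x : E) (G : E → Θ → F) (H : Θ → F) (θ₁ θ₂ : Θ),
      (∀ x' ∈ Metric.closedBall x ε, ∀ θ : Θ, ‖G x' θ - G x θ‖ ≤ K * ‖x' - x‖) ∧
      (∀ θ : Θ, ∃ xs ∈ Metric.closedBall x ε, H θ = G xs θ) ∧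
      ‖H θ₁ - H θ₂‖ = ‖G x θ₁ - G x θ₂‖ + 2 * ε * K := by
  refine ⟨ℝ, ℝ, ℝ, inferInstance, inferInstance, inferInstance, inferInstance, inferInstance,
    inferInstance, 0, fun x θ => K * x + θ, fun θ => K * (if 0 < θ then ε else -ε) + θ, 1, 0,
    ?_, ?_, ?_⟩
  · intro x' _ θ
    have h : K * x' + θ - (K * 0 + θ) = K * (x' - 0) := by ring
    rw [h, norm_mul, Real.norm_of_nonneg hK]
  · intro θ
    refine ⟨if 0 < θ then ε else -ε, ?_, rfl⟩
    split_ifs <;> simp [abs_of_nonneg hε]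
  · have h : K * ε + 1 - (K * -ε + 0) = 1 + 2 * ε * K := by ring
    have h_nonneg : 0 ≤ 1 + 2 * ε * K := by positivity
    simp only [zero_lt_one, lt_irrefl, if_true, if_false]
    rw [h, Real.norm_of_nonneg h_nonneg]
    simp
end

section
/- Let E, Θ, F be real normed vector spaces, let x ∈ E, and let ε ≥ 0, β ≥ 0, and K' ≥ 0 be real constants. Let A : Θ → F be any function and let M : E → Θ → F satisfy ‖M(x', θ)‖ ≤ K'·‖x' − x‖ for every x' in the closed ball of radius ε around x and every θ ∈ Θ. Suppose H' : Θ → F is a function such that for every θ ∈ Θ there exists a point x*(θ) in the closed ball of radius ε around x with H'(θ) = A(θ) + β·M(x*(θ), θ). Then for all θ₁, θ₂ ∈ Θ one has ‖H'(θ₁) − H'(θ₂)‖ ≤ ‖A(θ₁) − A(θ₂)‖ + 2·β·ε·K'. -/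
theorem trades_grad_stability
    {E Θ F : Type*} [NormedAddCommGroup E] [NormedSpace ℝ E]
    [NormedAddCommGroup Θ] [NormedSpace ℝ Θ]
    [NormedAddCommGroup F] [NormedSpace ℝ F]
    (x : E) (ε β K' : ℝ) (hε : 0 ≤ ε) (hβ : 0 ≤ β) (hK' : 0 ≤ K')
    (A : Θ → F) (M : E → Θ → F)
    (hM : ∀ x' ∈ Metric.closedBall x ε, ∀ θ : Θ, ‖M x' θ‖ ≤ K' * ‖x' - x‖)
    (H' : Θ → F)
    (hH' : ∀ θ : Θ, ∃ xs ∈ Metric.closedBall x ε, H' θ = A θ + β • M xs θ) :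
    ∀ θ₁ θ₂ : Θ, ‖H' θ₁ - H' θ₂‖ ≤ ‖A θ₁ - A θ₂‖ + 2 * β * ε * K' := by
  have hβM : ∀ x' ∈ Metric.closedBall x ε, ∀ θ : Θ, ‖β • M x' θ‖ ≤ β * (K' * ε) := by
    intro x' hx' θ
    rw [norm_smul, Real.norm_of_nonneg hβ]
    gcongr
    exact (hM x' hx' θ).trans
      (mul_le_mul_of_nonneg_left (mem_closedBall_iff_norm.mp hx') hK')
  intro θ₁ θ₂
  obtain ⟨x₁, hx₁, h₁⟩ := hH' θ₁
  obtain ⟨x₂, hx₂, h₂⟩ := hH' θ₂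
  rw [h₁, h₂, add_sub_add_comm]
  have hsum := norm_add_le (A θ₁ - A θ₂) (β • M x₁ θ₁ - β • M x₂ θ₂)
  have hsub := norm_sub_le (β • M x₁ θ₁) (β • M x₂ θ₂)
  linarith [hβM x₁ hx₁ θ₁, hβM x₂ hx₂ θ₂]
end
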